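/- Suppose F:Δ[0,T]×ℝ^d×ℝ^{d×d}×ℝ^{d×d}→ℝ is continuously differentiable, g:[0,T]×ℝ^d→ℝ is continuously differentiable in y, and u:Δ[0,T]×ℝ^d→ℝ solves the simplified nonlocal fully-nonlinear equation u_s(t,s,y)=F(t,s,y,u_{yy}(t,s,y),u_{yy}(s,s,y)), u(t,0,y)=g(t,y), with u thrice continuously differentiable with respect to y and such that the mixed derivatives ∂_{y_k}∂_s u and ∂_s∂_{y_k} u exist and coincide. Then the (1+d)-tuple (u, ∂u/∂y₁, …, ∂u/∂y_d) solves the induced nonlocal quasilinear system: u_s(t,s,y) = Σ_{i,j} u_{y_iy_j}(t,s,y) + Σ_{i,j} u_{y_iy_j}(s,s,y) + F(t,s,y, v_y(t,s,y), v_y(s,s,y)) − Σ_{i,j} v^{(i)}_{y_j}(t,s,y) − Σ_{i,j} v^{(i)}_{y_j}(s,s,y); v^{(k)}_s(t,s,y) = F_{y_k}(v) + Σ_{i,j} F_{q_{ij}}(v) v^{(k)}_{y_iy_j}(t,s,y) + Σ_{i,j} F_{n_{ij}}(v) v^{(k)}_{y_iy_j}(s,s,y) for k=1,…,d; (u, v^{(1)},…,v^{(d)})(t,0,y)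 = (g, g_{y₁},…,g_{y_d})(t,y); where v^{(k)}=∂u/∂y_k, v_y denotes the matrix (v^{(i)}_{y_j})_{i,j}, and F_{y_k}(v), F_{q_{ij}}(v), F_{n_{ij}}(v) are evaluated at (t,s,y, v_y(t,s,y), v_y(s,s,y)). -/

import Mathlib

noncomputable section

open scoped BigOperators

/-- Euclidean space `ℝ^d`. -/
abbrev Spc (d : ℕ) := EuclideanSpace ℝ (Fin d)

/-- First-order spatial partial derivative `∂f/∂y_k`. -/
def Dy1 {d : ℕ} (k : Fin d) (f : Spc d → ℝ) (y : Spc d) : ℝ :=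
  fderiv ℝ f y (EuclideanSpace.single k 1)

/-- Second-order spatial partial derivative `∂²w/∂y_i∂y_j` of `w(t,s,·)` at `y`. -/
def D2 {d : ℕ} (w : ℝ → ℝ → Spc d → ℝ) (t s : ℝ) (y : Spc d) (i j : Fin d) : ℝ :=
  Dy1 i (fun y' => Dy1 j (fun y'' => w t s y'') y') y

/-- The spatial Hessian `w_{yy}(t,s,y)`. -/
def Hess {d : ℕ} (w : ℝ → ℝ → Spc d → ℝ) (t s : ℝ) (y : Spc d) : Fin d → Fin d → ℝ :=
  fun i j => D2 w t s y i j

/-- `w_s`, the partial derivative in the running time. -/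
def uS {d : ℕ} (w : ℝ → ℝ → Spc d → ℝ) (t s : ℝ) (y : Spc d) : ℝ :=
  deriv (fun s' => w t s' y) s

/-- `w_t`, the partial derivative in the external time. -/
def uT {d : ℕ} (w : ℝ → ℝ → Spc d → ℝ) (t s : ℝ) (y : Spc d) : ℝ :=
  deriv (fun t' => w t' s y) t

/-- `w_{y_k}`. -/
def uY {d : ℕ} (k : Fin d) (w : ℝ → ℝ → Spc d → ℝ) (t s : ℝ) (y : Spc d) : ℝ :=
  Dy1 k (fun y' => w t s y') y

/-- The matrix unit `e_{ij}`, direction for differentiating in a matrix entry. -/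
def EB {d : ℕ} (i j : Fin d) : Fin d → Fin d → ℝ :=
  fun a b => if a = i then (if b = j then 1 else 0) else 0

/-- `F_{y_k}`, partial derivative of `F(t,s,y,q,n)` with respect to `y_k`. -/
def Fy {d : ℕ} (F : ℝ → ℝ → Spc d → (Fin d → Fin d → ℝ) → (Fin d → Fin d → ℝ) → ℝ)
    (k : Fin d) (t s : ℝ) (y : Spc d) (q n : Fin d → Fin d → ℝ) : ℝ :=
  fderiv ℝ (fun y' => F t s y' q n) y (EuclideanSpace.single k 1)

/-- `F_{q_{ij}}`, partial derivative of `F` with respect to the entry `q_{ij}`. -/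
def Fq {d : ℕ} (F : ℝ → ℝ → Spc d → (Fin d → Fin d → ℝ) → (Fin d → Fin d → ℝ) → ℝ)
    (i j : Fin d) (t s : ℝ) (y : Spc d) (q n : Fin d → Fin d → ℝ) : ℝ :=
  fderiv ℝ (fun q' => F t s y q' n) q (EB i j)

/-- `F_{n_{ij}}`, partial derivative of `F` with respect to the entry `n_{ij}`. -/
def Fn {d : ℕ} (F : ℝ → ℝ → Spc d → (Fin d → Fin d → ℝ) → (Fin d → Fin d → ℝ) → ℝ)
    (i j : Fin d) (t s : ℝ) (y : Spc d) (q n : Fin d → Fin d → ℝ) : ℝ :=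
  fderiv ℝ (fun n' => F t s y q n') n (EB i j)

/-- `F_s`, partial derivative of `F` with respect to the running time slot. -/
def Fs {d : ℕ} (F : ℝ → ℝ → Spc d → (Fin d → Fin d → ℝ) → (Fin d → Fin d → ℝ) → ℝ)
    (t s : ℝ) (y : Spc d) (q n : Fin d → Fin d → ℝ) : ℝ :=
  deriv (fun s' => F t s' y q n) s

/-- `F_t`, partial derivative of `F` with respect to the external time slot. -/
def Ft {d : ℕ} (F : ℝ → ℝ → Spc d → (Fin d → Fin d → ℝ) → (Fin d → Fin d → ℝ) → ℝ)
    (t s : ℝ) (y : Spc d) (q n : Fin d → Fin d → ℝ) : ℝ :=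
  deriv (fun t' => F t' s y q n) t

/-- The matrix `v_y = (v^{(i)}_{y_j})_{i,j}`. -/
def Vy {d : ℕ} (v : Fin d → ℝ → ℝ → Spc d → ℝ) (t s : ℝ) (y : Spc d) : Fin d → Fin d → ℝ :=
  fun i j => Dy1 j (fun y' => v i t s y') y

/-- `u` solves the simplified nonlocal fully-nonlinear equation
`u_s(t,s,y) = F(t,s,y,u_{yy}(t,s,y),u_{yy}(s,s,y))`, `u(t,0,y) = g(t,y)`, on `Δ[0,T] × ℝ^d`. -/
def SolvesFNL {d : ℕ} (F : ℝ → ℝ → Spc d → (Fin d → Fin d → ℝ) → (Fin d → Fin d → ℝ) → ℝ)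
    (g : ℝ → Spc d → ℝ) (T : ℝ) (u : ℝ → ℝ → Spc d → ℝ) : Prop :=
  (∀ t s : ℝ, ∀ y : Spc d, 0 ≤ s → s ≤ t → t ≤ T →
    uS u t s y = F t s y (Hess u t s y) (Hess u s s y))
  ∧ (∀ t ∈ Set.Icc (0 : ℝ) T, ∀ y : Spc d, u t 0 y = g t y)

/-- `(u, v^{(1)}, …, v^{(d)})` solves the induced nonlocal quasilinear system on `Δ[0,T] × ℝ^d`. -/
def SolvesInduced {d : ℕ} (F : ℝ → ℝ → Spc d → (Fin d → Fin d → ℝ) → (Fin d → Fin d → ℝ) → ℝ)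
    (g : ℝ → Spc d → ℝ) (T : ℝ) (u : ℝ → ℝ → Spc d → ℝ)
    (v : Fin d → ℝ → ℝ → Spc d → ℝ) : Prop :=
  (∀ t s : ℝ, ∀ y : Spc d, 0 ≤ s → s ≤ t → t ≤ T →
    uS u t s y =
      (∑ i : Fin d, ∑ j : Fin d, D2 u t s y i j) + (∑ i : Fin d, ∑ j : Fin d, D2 u s s y i j)
      + F t s y (Vy v t s y) (Vy v s s y)
      - (∑ i : Fin d, ∑ j : Fin d, Vy v t s y i j)
      - (∑ i : Fin d, ∑ j : Fin d, Vy v s s y i j))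
  ∧ (∀ k : Fin d, ∀ t s : ℝ, ∀ y : Spc d, 0 ≤ s → s ≤ t → t ≤ T →
      uS (v k) t s y =
        Fy F k t s y (Vy v t s y) (Vy v s s y)
        + (∑ i : Fin d, ∑ j : Fin d,
            Fq F i j t s y (Vy v t s y) (Vy v s s y) * D2 (v k) t s y i j)
        + (∑ i : Fin d, ∑ j : Fin d,
            Fn F i j t s y (Vy v t s y) (Vy v s s y) * D2 (v k) s s y i j))
  ∧ (∀ t ∈ Set.Icc (0 : ℝ) T, ∀ y : Spc d,
      u t 0 y = g t y ∧ ∀ k : Fin d, v k t 0 y = Dy1 k (fun y' => g t y') y)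
theorem Dy1_contDiff {d : ℕ} {n m : WithTop ℕ∞} {f : Spc d → ℝ} (hf : ContDiff ℝ n f)
    (hmn : m + 1 ≤ n) (k : Fin d) : ContDiff ℝ m (Dy1 k f) :=
  (hf.fderiv_right hmn).clm_apply contDiff_const

theorem Dy1_comm {d : ℕ} {f : Spc d → ℝ} (hf : ContDiff ℝ 2 f) (i j : Fin d) (y : Spc d) :
    Dy1 i (Dy1 j f) y = Dy1 j (Dy1 i f) y := by
  have hd : DifferentiableAt ℝ (fderiv ℝ f) y :=
    (hf.fderiv_right (m := 1) (by norm_num)).differentiable (by norm_num) y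
  have key (a b : Fin d) : Dy1 a (Dy1 b f) y =
      fderiv ℝ (fderiv ℝ f) y (EuclideanSpace.single a 1) (EuclideanSpace.single b 1) := by
    have h := hd.hasFDerivAt.clm_apply
      (hasFDerivAt_const (EuclideanSpace.single b (1 : ℝ) : Spc d) y)
    change fderiv ℝ (fun z => fderiv ℝ f z (EuclideanSpace.single b 1)) y _ = _
    rw [h.fderiv]
    simp
  rw [key, key]
  exact (hf.contDiffAt.isSymmSndFDerivAt (by simp)) _ _

theorem sum_smul_EB {d : ℕ} (M : Fin d → Fin d → ℝ) :
    M = ∑ i : Fin d, ∑ j : Fin d, M i j • EB i j := by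
  funext a b
  simp [Finset.sum_apply, EB]

/-- Chain rule for `y ↦ F(t,s,y,A(y),B(y))`. -/
theorem Dy1_comp {d : ℕ}
    {F : ℝ → ℝ → Spc d → (Fin d → Fin d → ℝ) → (Fin d → Fin d → ℝ) → ℝ}
    (hF : ContDiff ℝ 1 (fun p : ℝ × ℝ × Spc d × (Fin d → Fin d → ℝ) × (Fin d → Fin d → ℝ) =>
      F p.1 p.2.1 p.2.2.1 p.2.2.2.1 p.2.2.2.2))
    {A B : Spc d → Fin d → Fin d → ℝ} (k : Fin d) (t s : ℝ) (y : Spc d)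
    (hA : ∀ i j, DifferentiableAt ℝ (fun z => A z i j) y)
    (hB : ∀ i j, DifferentiableAt ℝ (fun z => B z i j) y) :
    Dy1 k (fun z => F t s z (A z) (B z)) y =
      Fy F k t s y (A y) (B y)
      + (∑ i : Fin d, ∑ j : Fin d, Fq F i j t s y (A y) (B y) * Dy1 k (fun z => A z i j) y)
      + (∑ i : Fin d, ∑ j : Fin d, Fn F i j t s y (A y) (B y) * Dy1 k (fun z => B z i j) y) := by
  set G := fun p : ℝ × ℝ × Spc d × (Fin d → Fin d → ℝ) × (Fin d → Fin d → ℝ) =>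
      F p.1 p.2.1 p.2.2.1 p.2.2.2.1 p.2.2.2.2 with hG
  set L := fderiv ℝ G (t, s, y, A y, B y) with hL
  have hGd : HasFDerivAt G L (t, s, y, A y, B y) :=
    (hF.differentiable (by norm_num) _).hasFDerivAt
  have entries {C : Spc d → Fin d → Fin d → ℝ}
      (hC : ∀ i j, DifferentiableAt ℝ (fun z => C z i j) y) :
      HasFDerivAt C (ContinuousLinearMap.pi fun i => ContinuousLinearMap.pi fun j =>
        fderiv ℝ (fun z => C z i j) y) y :=
    hasFDerivAt_pi.2 fun i => hasFDerivAt_pi.2 fun j => (hC i j).hasFDerivAt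
  have hy : Fy F k t s y (A y) (B y) = L (0, 0, EuclideanSpace.single k 1, 0, 0) := by
    have h := HasFDerivAt.comp (f := fun z => (t, s, z, A y, B y)) y hGd
      ((hasFDerivAt_const t y).prodMk ((hasFDerivAt_const s y).prodMk
      ((hasFDerivAt_id y).prodMk ((hasFDerivAt_const (A y) y).prodMk
        (hasFDerivAt_const (B y) y)))))
    have h' : fderiv ℝ (fun z => F t s z (A y) (B y)) y = _ := h.fderiv
    rw [Fy, h']
    rfl
  have hq (i j : Fin d) : Fq F i j t s y (A y) (B y) = L (0, 0, 0, EB i j, 0) := by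
    have h := HasFDerivAt.comp (f := fun z => (t, s, y, z, B y)) (A y) hGd
      ((hasFDerivAt_const t (A y)).prodMk
      ((hasFDerivAt_const s (A y)).prodMk ((hasFDerivAt_const y (A y)).prodMk
        ((hasFDerivAt_id (A y)).prodMk (hasFDerivAt_const (B y) (A y))))))
    have h' : fderiv ℝ (fun z => F t s y z (B y)) (A y) = _ := h.fderiv
    rw [Fq, h']
    rfl
  have hn (i j : Fin d) : Fn F i j t s y (A y) (B y) = L (0, 0, 0, 0, EB i j) := by
    have h := HasFDerivAt.comp (f := fun z => (t, s, y, A y, z)) (B y) hGd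
      ((hasFDerivAt_const t (B y)).prodMk
      ((hasFDerivAt_const s (B y)).prodMk ((hasFDerivAt_const y (B y)).prodMk
        ((hasFDerivAt_const (A y) (B y)).prodMk (hasFDerivAt_id (B y))))))
    have h' : fderiv ℝ (fun z => F t s y (A y) z) (B y) = _ := h.fderiv
    rw [Fn, h']
    rfl
  set a : Fin d → Fin d → ℝ := fun i j => Dy1 k (fun z => A z i j) y with ha
  set b : Fin d → Fin d → ℝ := fun i j => Dy1 k (fun z => B z i j) y with hb
  have hmain : Dy1 k (fun z => F t s z (A z) (B z)) y =
      L (0, 0, EuclideanSpace.single k 1, a, b) := by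
    have h := HasFDerivAt.comp (f := fun z => (t, s, z, A z, B z)) y hGd
      ((hasFDerivAt_const t y).prodMk ((hasFDerivAt_const s y).prodMk
      ((hasFDerivAt_id y).prodMk ((entries hA).prodMk (entries hB)))))
    have h' : fderiv ℝ (fun z => F t s z (A z) (B z)) y = _ := h.fderiv
    rw [Dy1, h']
    rfl
  let Lq : (Fin d → Fin d → ℝ) →ₗ[ℝ] ℝ :=
    L.toLinearMap ∘ₗ LinearMap.inr ℝ _ _ ∘ₗ LinearMap.inr ℝ _ _ ∘ₗ LinearMap.inr ℝ _ _ ∘ₗ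
      LinearMap.inl ℝ _ _
  let Ln : (Fin d → Fin d → ℝ) →ₗ[ℝ] ℝ :=
    L.toLinearMap ∘ₗ LinearMap.inr ℝ _ _ ∘ₗ LinearMap.inr ℝ _ _ ∘ₗ LinearMap.inr ℝ _ _ ∘ₗ
      LinearMap.inr ℝ _ _
  have expand (M : (Fin d → Fin d → ℝ) →ₗ[ℝ] ℝ) (c : Fin d → Fin d → ℝ) :
      M c = ∑ i : Fin d, ∑ j : Fin d, M (EB i j) * c i j := by
    conv_lhs => rw [sum_smul_EB c]
    simp [map_sum, mul_comm]
  have hsplit : L (0, 0, EuclideanSpace.single k 1, a, b) =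
      L (0, 0, EuclideanSpace.single k 1, 0, 0) + Lq a + Ln b := by
    change _ = L (0, 0, EuclideanSpace.single k 1, 0, 0) + L (0, 0, 0, a, 0) + L (0, 0, 0, 0, b)
    rw [← map_add, ← map_add]
    simp
  rw [hmain, hsplit, hy, expand Lq a, expand Ln b]
  simp only [hq, hn]
  rfl

theorem Vy_uY_eq_Hess {d : ℕ} {u : ℝ → ℝ → Spc d → ℝ} {t s : ℝ}
    (h : ContDiff ℝ 2 (fun y => u t s y)) (y : Spc d) :
    Vy (fun k t s y => uY k u t s y) t s y = Hess u t s y := by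
  funext i j
  exact Dy1_comm h j i y

theorem Dy1_D2 {d : ℕ} {u : ℝ → ℝ → Spc d → ℝ} {t s : ℝ}
    (h : ContDiff ℝ 3 (fun y => u t s y)) (k i j : Fin d) (y : Spc d) :
    Dy1 k (fun z => D2 u t s z i j) y = D2 (fun t s y => uY k u t s y) t s y i j := by
  have h1 : Dy1 k (Dy1 j (u t s)) = Dy1 j (Dy1 k (u t s)) :=
    funext fun z => Dy1_comm (h.of_le (by norm_num)) k j z
  have h2 := Dy1_comm (Dy1_contDiff h (m := 2) (by norm_num) j) k i y
  change Dy1 k (Dy1 i (Dy1 j (u t s))) y = Dy1 i (Dy1 j (Dy1 k (u t s))) y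
  rw [← h1]
  exact h2

/-- Lemma 3.2, first claim: if `u` solves the simplified nonlocal fully-nonlinear
equation and is regular enough, then `(u, ∂u/∂y₁, …, ∂u/∂y_d)` solves the induced nonlocal
quasilinear system. -/
theorem fully_nonlinear_to_quasilinear
    (d : ℕ) (hd : 0 < d) (T : ℝ) (hT : 0 < T)
    (F : ℝ → ℝ → Spc d → (Fin d → Fin d → ℝ) → (Fin d → Fin d → ℝ) → ℝ)
    (g : ℝ → Spc d → ℝ) (u : ℝ → ℝ → Spc d → ℝ)
    -- `F` is continuously differentiable
    (hF : ContDiff ℝ 1 (fun p : ℝ × ℝ × Spc d × (Fin d → Fin d → ℝ) × (Fin d → Fin d → ℝ) =>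
      F p.1 p.2.1 p.2.2.1 p.2.2.2.1 p.2.2.2.2))
    -- `g` is continuously differentiable in `y`
    (hg : ∀ t : ℝ, ContDiff ℝ 1 (fun y : Spc d => g t y))
    -- `u` solves the simplified nonlocal fully-nonlinear equation
    (hsol : SolvesFNL F g T u)
    -- `u` is thrice continuously differentiable with respect to `y`
    (hreg : ∀ t s : ℝ, ContDiff ℝ 3 (fun y : Spc d => u t s y))
    -- the mixed derivatives `∂_{y_k}∂_s u` and `∂_s∂_{y_k} u` exist and coincide
    (hmixex : ∀ k : Fin d, ∀ t s : ℝ, ∀ y : Spc d, 0 ≤ s → s ≤ t → t ≤ T →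
      DifferentiableAt ℝ (fun s' => uY k u t s' y) s
      ∧ DifferentiableAt ℝ (fun y' => uS u t s y') y)
    (hmix : ∀ k : Fin d, ∀ t s : ℝ, ∀ y : Spc d, 0 ≤ s → s ≤ t → t ≤ T →
      Dy1 k (fun y' => uS u t s y') y = deriv (fun s' => uY k u t s' y) s) :
    SolvesInduced F g T u (fun k t s y => uY k u t s y) := by
  have hV (t s : ℝ) (y : Spc d) := Vy_uY_eq_Hess ((hreg t s).of_le (by norm_num)) y
  have hdiff (t s : ℝ) (y : Spc d) (i j : Fin d) :
      DifferentiableAt ℝ (fun z => Hess u t s z i j) y :=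
    (Dy1_contDiff (Dy1_contDiff (hreg t s) (m := 2) (by norm_num) j) (m := 1) (by norm_num)
      i).differentiable (by norm_num) y
  refine ⟨fun t s y h0 hst hT => ?_, fun k t s y h0 hst hT => ?_, fun t ht y => ⟨hsol.2 t ht y, ?_⟩⟩
  · rw [hV, hV, hsol.1 t s y h0 hst hT]
    simp only [Hess]
    ring
  · have heq : (fun y' => uS u t s y') =
        fun y' => F t s y' (Hess u t s y') (Hess u s s y') :=
      funext fun z => hsol.1 t s z h0 hst hT
    have hmixed := hmix k t s y h0 hst hT
    rw [heq, Dy1_comp hF k t s y (hdiff t s y) (hdiff s s y)] at hmixed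
    rw [hV, hV]
    simp only [Hess, Dy1_D2 (hreg _ _)] at hmixed
    exact hmixed.symm
  · intro k
    have heq : (fun y' => u t 0 y') = fun y' => g t y' := funext fun z => hsol.2 t ht z
    change Dy1 k (fun y' => u t 0 y') y = _
    rw [heq]

end
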